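/- arXiv:2110.07041 — 2 statements merged into one kernel-verified Lean document; each statement's English description precedes it below -/
import Mathlib

section
/- Let $\mu$ be a probability measure on a measurable space $\Omega$, let $f : \Omega \to \mathbb{R}$ be measurable and integrable with respect to $\mu$, and let $\alpha \in (0,1)$. Define $h(c) = c + (1-\alpha)^{-1} \int \max(f(\omega) - c, 0)\,d\mu(\omega)$ and let $q = Q(f;\alpha) = \inf\{x \in \mathbb{R} : \mu\{\omega : f(\omega) \leq x\} \geq \alpha\}$ be the $\alpha$-quantile of $f$. Then $h(q) = \inf_{c \in \mathbb{R}} h(c)$; that is, the $\alpha$-quantile attains the infimum in the Rockafellar–Uryasev formula for CVaR, so $\mathrm{CVaR}(f;\alpha) = h(Q(f;\alpha))$. -/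
open MeasureTheory

/-- The `α`-quantile of `f` under `μ`. -/
noncomputable def quantile {Ω : Type*} [MeasurableSpace Ω] (μ : Measure Ω)
    (f : Ω → ℝ) (α : ℝ) : ℝ :=
  sInf {x : ℝ | ENNReal.ofReal α ≤ μ {ω | f ω ≤ x}}

/-- The Rockafellar–Uryasev auxiliary function `h(c) = c + (1-α)⁻¹ E[(f - c)₊]`. -/
noncomputable def cvarAux {Ω : Type*} [MeasurableSpace Ω] (μ : Measure Ω)
    (f : Ω → ℝ) (α c : ℝ) : ℝ :=
  c + (1 - α)⁻¹ * ∫ ω, max (f ω - c) 0 ∂μ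

section Quantile

open Filter Topology ProbabilityTheory

variable {Ω : Type*} [MeasurableSpace Ω] {μ : Measure Ω} [IsProbabilityMeasure μ]
  {f : Ω → ℝ} {α : ℝ}

lemma cdf_map_eq_real (hf : Measurable f) (x : ℝ) :
    cdf (μ.map f) x = μ.real {ω | f ω ≤ x} := by
  have := Measure.isProbabilityMeasure_map (μ := μ) hf.aemeasurable
  rw [cdf_eq_real, map_measureReal_apply hf measurableSet_Iic]
  rfl

lemma quantile_eq_sInf_cdf (hf : Measurable f) :
    quantile μ f α = sInf {x : ℝ | α ≤ cdf (μ.map f) x} := by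
  simp_rw [quantile, cdf_map_eq_real hf, measureReal_def,
    ENNReal.ofReal_le_iff_le_toReal (measure_ne_top μ _)]

lemma le_measureReal_le_quantile (hf : Measurable f) (hα : α < 1) :
    α ≤ μ.real {ω | f ω ≤ quantile μ f α} := by
  rw [← cdf_map_eq_real hf]
  have hne : {x : ℝ | α ≤ cdf (μ.map f) x}.Nonempty :=
    ((tendsto_cdf_atTop (μ.map f)).eventually (eventually_ge_nhds hα)).exists
  have hlim : Tendsto (cdf (μ.map f)) (𝓝[>] (quantile μ f α))
      (𝓝 (cdf (μ.map f) (quantile μ f α))) :=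
    ((cdf (μ.map f)).right_continuous _).mono_left (nhdsWithin_mono _ Set.Ioi_subset_Ici_self)
  refine ge_of_tendsto hlim ?_
  filter_upwards [self_mem_nhdsWithin] with x hx
  rw [Set.mem_Ioi, quantile_eq_sInf_cdf hf] at hx
  obtain ⟨y, hy, hyx⟩ := exists_lt_of_csInf_lt hne hx
  exact le_trans hy (monotone_cdf _ hyx.le)

lemma measureReal_lt_quantile_le (hf : Measurable f) (hα : 0 < α) :
    μ.real {ω | f ω < quantile μ f α} ≤ α := by
  have := Measure.isProbabilityMeasure_map (μ := μ) hf.aemeasurable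
  have hbdd : BddBelow {x : ℝ | α ≤ cdf (μ.map f) x} := by
    obtain ⟨b, hb⟩ := ((tendsto_cdf_atBot (μ.map f)).eventually (eventually_lt_nhds hα)).exists
    exact ⟨b, fun x hx => le_of_not_gt fun hxb =>
      (hx.trans (monotone_cdf _ hxb.le)).not_gt hb⟩
  have hlim : Function.leftLim (cdf (μ.map f)) (quantile μ f α) ≤ α := by
    refine le_of_tendsto ((monotone_cdf (μ.map f)).tendsto_leftLim _) ?_
    filter_upwards [self_mem_nhdsWithin] with x hx
    rw [Set.mem_Iio, quantile_eq_sInf_cdf hf] at hx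
    exact (not_le.mp fun h => notMem_of_lt_csInf hx hbdd h).le
  have hmeas := (cdf (μ.map f)).measure_Iio (tendsto_cdf_atBot _) (quantile μ f α)
  rw [measure_cdf, Measure.map_apply hf measurableSet_Iio, sub_zero] at hmeas
  refine ENNReal.toReal_le_of_le_ofReal hα.le ?_
  exact hmeas.trans_le (ENNReal.ofReal_le_ofReal hlim)

lemma integrable_max_sub_zero (hf : Integrable f μ) (c : ℝ) :
    Integrable (fun ω => max (f ω - c) 0) μ :=
  (hf.sub (integrable_const c)).pos_part

/-- The mass of any set between `{q < f}` and `{q ≤ f}` is, up to sign, a subgradient at `q` of the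
expected excess `c ↦ E[(f - c)₊]`. -/
lemma integral_max_sub_add_le (hf : Integrable f μ) {A : Set Ω} (hA : MeasurableSet A) {q : ℝ}
    (hqA : {ω | q < f ω} ⊆ A) (hAq : A ⊆ {ω | q ≤ f ω}) (c : ℝ) :
    (∫ ω, max (f ω - q) 0 ∂μ) + (q - c) * μ.real A ≤ ∫ ω, max (f ω - c) 0 ∂μ := by
  have hind : Integrable (A.indicator fun _ => q - c) μ := (integrable_const _).indicator hA
  have hint : ∫ ω, A.indicator (fun _ => q - c) ω ∂μ = (q - c) * μ.real A := by
    rw [integral_indicator_const _ hA, smul_eq_mul, mul_comm]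
  rw [← hint, ← integral_add (integrable_max_sub_zero hf q) hind]
  refine integral_mono ((integrable_max_sub_zero hf q).add hind)
    (integrable_max_sub_zero hf c) fun ω => ?_
  by_cases hω : ω ∈ A
  · have hq : q ≤ f ω := hAq hω
    simp [hω, max_eq_left (sub_nonneg.mpr hq)]
  · have hq : f ω ≤ q := not_lt.mp fun h => hω (hqA h)
    simp [hω, max_eq_right (sub_nonpos.mpr hq)]

lemma cvarAux_quantile_le (hf_meas : Measurable f) (hf_int : Integrable f μ)
    (hα : α ∈ Set.Ioo (0 : ℝ) 1) (c : ℝ) :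
    cvarAux μ f α (quantile μ f α) ≤ cvarAux μ f α c := by
  set q := quantile μ f α
  have hα' : 0 < 1 - α := sub_pos.mpr hα.2
  have key : (∫ ω, max (f ω - q) 0 ∂μ) + (q - c) * (1 - α) ≤ ∫ ω, max (f ω - c) 0 ∂μ := by
    rcases le_total q c with hqc | hcq
    · have hA : MeasurableSet {ω | f ω ≤ q} := measurableSet_le hf_meas measurable_const
      have hmass : μ.real {ω | f ω ≤ q}ᶜ ≤ 1 - α := by
        rw [probReal_compl_eq_one_sub hA]
        linarith [le_measureReal_le_quantile (μ := μ) hf_meas hα.2]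
      have h := integral_max_sub_add_le hf_int hA.compl (q := q)
        (fun ω hω => by simpa using hω) (fun ω hω => le_of_lt (by simpa using hω)) c
      linarith [mul_le_mul_of_nonpos_left hmass (sub_nonpos.mpr hqc)]
    · have hA : MeasurableSet {ω | f ω < q} := measurableSet_lt hf_meas measurable_const
      have hmass : 1 - α ≤ μ.real {ω | f ω < q}ᶜ := by
        rw [probReal_compl_eq_one_sub hA]
        linarith [measureReal_lt_quantile_le (μ := μ) hf_meas hα.1]
      have h := integral_max_sub_add_le hf_int hA.compl (q := q)
        (fun ω hω => by simpa using le_of_lt hω) (fun ω hω => by simpa using hω) c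
      linarith [mul_le_mul_of_nonneg_left hmass (sub_nonneg.mpr hcq)]
  have h := mul_le_mul_of_nonneg_left key (inv_pos.mpr hα').le
  have hcancel : (1 - α)⁻¹ * ((q - c) * (1 - α)) = q - c := by field_simp
  rw [mul_add, hcancel] at h
  unfold cvarAux
  linarith

end Quantile

/-- The `α`-quantile attains the infimum in the Rockafellar–Uryasev formula for
CVaR: `CVaR(f;α) = h(Q(f;α))`. -/
theorem quantile_attains_cvar_inf
    {Ω : Type*} [MeasurableSpace Ω] (μ : Measure Ω) [IsProbabilityMeasure μ]
    (f : Ω → ℝ) (hf_meas : Measurable f) (hf_int : Integrable f μ)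
    (α : ℝ) (hα : α ∈ Set.Ioo (0 : ℝ) 1) :
    cvarAux μ f α (quantile μ f α) = ⨅ c : ℝ, cvarAux μ f α c := by
  have hmin := cvarAux_quantile_le hf_meas hf_int hα
  exact le_antisymm (le_ciInf hmin) (ciInf_le ⟨_, Set.forall_mem_range.mpr hmin⟩ _)
end

section
/- Let $\mu$ be a probability measure on a measurable space $\Omega$, let $f : \Omega \to \mathbb{R}$ be measurable and integrable with respect to $\mu$, let $\alpha \in (0,1)$, and let $q = Q(f;\alpha)$ be the $\alpha$-quantile of $f$. If $\mu\{\omega : f(\omega) \geq q\} = 1 - \alpha$, then $\mathrm{CVaR}(f;\alpha) = (1-\alpha)^{-1} \int_{\{\omega : f(\omega) \geq q\}} f(\omega)\,d\mu(\omega)$; that is, CVaR equals the expectation of $f$ conditional on $f$ exceeding its $\alpha$-quantile. -/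
open MeasureTheory

/-- The conditional-value-at-risk of `f` under `μ` at level `α`. -/
noncomputable def cvar {Ω : Type*} [MeasurableSpace Ω] (μ : Measure Ω)
    (f : Ω → ℝ) (α : ℝ) : ℝ :=
  ⨅ c : ℝ, (c + (1 - α)⁻¹ * ∫ ω, max (f ω - c) 0 ∂μ)

/-- Over a set of mass `p > 0`, the rescaled integral of `f` splits off any constant `c`. -/
theorem inv_mul_setIntegral_eq_add {Ω : Type*} [MeasurableSpace Ω] {μ : Measure Ω}
    [IsFiniteMeasure μ] {f : Ω → ℝ} (hf : Integrable f μ) {s : Set Ω} {p : ℝ} (hp : 0 < p)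
    (hs : μ.real s = p) (c : ℝ) :
    p⁻¹ * ∫ ω in s, f ω ∂μ = c + p⁻¹ * ∫ ω in s, (f ω - c) ∂μ := by
  rw [integral_sub hf.integrableOn (integrable_const c), setIntegral_const, hs, smul_eq_mul]
  field_simp
  ring

theorem setIntegral_sub_le_integral_max {Ω : Type*} [MeasurableSpace Ω] {μ : Measure Ω}
    [IsFiniteMeasure μ] {f : Ω → ℝ} (hf : Integrable f μ) (s : Set Ω) (c : ℝ) :
    ∫ ω in s, (f ω - c) ∂μ ≤ ∫ ω, max (f ω - c) 0 ∂μ := by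
  have hsub : Integrable (fun ω => f ω - c) μ := hf.sub (integrable_const c)
  exact (integral_mono hsub.integrableOn hsub.pos_part.integrableOn
    fun _ => le_max_left _ _).trans
      (setIntegral_le_integral hsub.pos_part (ae_of_all _ fun _ => le_max_right _ _))

theorem integral_max_sub_eq_setIntegral {Ω : Type*} [MeasurableSpace Ω] {μ : Measure Ω}
    {f : Ω → ℝ} (hf : Measurable f) (q : ℝ) :
    ∫ ω, max (f ω - q) 0 ∂μ = ∫ ω in {ω | q ≤ f ω}, (f ω - q) ∂μ := by
  rw [← integral_indicator (measurableSet_le measurable_const hf)]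
  congr 1 with ω
  by_cases h : q ≤ f ω
  · simp [h]
  · simp [h, le_of_not_ge h]

/-- If the upper tail `{f ≥ Q(f;α)}` has mass exactly `1 - α`, then CVaR equals the
expectation of `f` conditional on `f` exceeding its `α`-quantile. -/
theorem cvar_eq_tail_expectation
    {Ω : Type*} [MeasurableSpace Ω] (μ : Measure Ω) [IsProbabilityMeasure μ]
    (f : Ω → ℝ) (hf_meas : Measurable f) (hf_int : Integrable f μ)
    (α : ℝ) (hα : α ∈ Set.Ioo (0 : ℝ) 1)
    (htail : μ {ω | quantile μ f α ≤ f ω} = ENNReal.ofReal (1 - α)) :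
    cvar μ f α = (1 - α)⁻¹ * ∫ ω in {ω | quantile μ f α ≤ f ω}, f ω ∂μ := by
  have hp : 0 < 1 - α := sub_pos.mpr hα.2
  have hmass : μ.real {ω | quantile μ f α ≤ f ω} = 1 - α := by
    rw [measureReal_def, htail, ENNReal.toReal_ofReal hp.le]
  have hsplit := inv_mul_setIntegral_eq_add hf_int hp hmass
  have hleast : IsLeast (Set.range fun c : ℝ => c + (1 - α)⁻¹ * ∫ ω, max (f ω - c) 0 ∂μ)
      ((1 - α)⁻¹ * ∫ ω in {ω | quantile μ f α ≤ f ω}, f ω ∂μ) := by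
    refine ⟨⟨quantile μ f α, ?_⟩, ?_⟩
    · rw [hsplit (quantile μ f α)]
      simp only [integral_max_sub_eq_setIntegral hf_meas]
    · rintro _ ⟨c, rfl⟩
      rw [hsplit c]
      dsimp only
      gcongr
      exact setIntegral_sub_le_integral_max hf_int _ c
  exact hleast.csInf_eq
end
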